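/- arXiv:2605.30213 — 2 statements merged into one kernel-verified Lean document; each statement's English description precedes it below -/
import Mathlib

section
/- Fix T > 0 and m ∈ ℕ, and let t = (t₀, …, t_{m−1}) be a strictly increasing tuple with all entries in [0, T]. Then q_t is nondecreasing and 1-Lipschitz on [0, T+m+1], satisfies q_t(0) = 0 and q_t(T+m+1) = T, and maps [0, T+m+1] onto [0, T]; in particular, for every s ∈ [0, T] there exists u ∈ [0, T+m+1] with q_t(u) = s. -/
/-- `clamp s = min 1 (max 0 s)`. -/
noncomputable def clamp (s : ℝ) : ℝ := min 1 (max 0 s)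

/-- The physical-time coordinate `q_t` of the realised path for event times `t`. -/
noncomputable def qt {m : ℕ} (t : Fin m → ℝ) (u : ℝ) : ℝ :=
  u - clamp u - ∑ i : Fin m, clamp (u - 1 - t i - (i : ℝ))

theorem clamp_monotone : Monotone clamp := fun _ _ h =>
  min_le_min le_rfl (max_le_max le_rfl h)

theorem clamp_of_nonpos {s : ℝ} (h : s ≤ 0) : clamp s = 0 := by
  simp [clamp, h]

theorem clamp_of_one_le {s : ℝ} (h : 1 ≤ s) : clamp s = 1 := by
  simp [clamp, h]

theorem continuous_clamp : Continuous clamp :=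
  continuous_const.min (continuous_const.max continuous_id)

theorem clamp_sub_eq (u a : ℝ) : clamp (u - a) = min u (a + 1) - min u a := by
  unfold clamp
  grind

theorem monotone_min_sub_min {a b : ℝ} (h : a ≤ b) :
    Monotone fun u : ℝ => min u b - min u a := by
  intro u v huv
  dsimp only
  grind

theorem continuous_qt {m : ℕ} (t : Fin m → ℝ) : Continuous (qt t) := by
  unfold qt
  exact (continuous_id.sub continuous_clamp).sub
    (continuous_finsetSum _ fun i _ => continuous_clamp.comp (by fun_prop))

/-- Truncating the leading `u` of `q_t` at a level `b` to the right of all the unit intervals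
leaves a function that is nondecreasing on the whole line. -/
theorem monotone_min_sub_sum_clamp {m : ℕ} (t : Fin m → ℝ) (ht : StrictMono t)
    (ht0 : ∀ i, 0 ≤ t i) (b : ℝ) (hb : 1 ≤ b) (htb : ∀ i, 1 + t i + (i : ℝ) + 1 ≤ b) :
    Monotone fun u : ℝ => min u b - clamp u - ∑ i : Fin m, clamp (u - 1 - t i - (i : ℝ)) := by
  induction m generalizing b with
  | zero =>
    intro u v huv
    simp only [Finset.univ_eq_empty, Finset.sum_empty, sub_zero]
    unfold clamp
    grind
  | succ n ih =>
    set a : ℝ := 1 + t (Fin.last n) + n with ha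
    have hlast : a + 1 ≤ b := by simpa [ha] using htb (Fin.last n)
    have ih := ih (fun i => t i.castSucc) (ht.comp Fin.strictMono_castSucc) (fun i => ht0 _) a
      (by have := ht0 (Fin.last n); have : (0 : ℝ) ≤ n := n.cast_nonneg; linarith)
      (fun i => by
        have h1 := ht i.castSucc_lt_last
        have h2 : ((i : ℕ) : ℝ) + 1 ≤ n := by exact_mod_cast i.isLt
        linarith)
    convert ih.add (monotone_min_sub_min hlast) using 2 with u
    have hc : clamp (u - 1 - t (Fin.last n) - n) = min u (a + 1) - min u a := by
      rw [← clamp_sub_eq]; congr 1; rw [ha]; ring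
    simp only [Fin.sum_univ_castSucc, Fin.val_castSucc, Fin.val_last, hc]
    ring

theorem qt_sub_qt_le {m : ℕ} (t : Fin m → ℝ) {u v : ℝ} (h : u ≤ v) :
    qt t v - qt t u ≤ v - u := by
  have h1 : clamp u ≤ clamp v := clamp_monotone h
  have h2 : ∑ i : Fin m, clamp (u - 1 - t i - (i : ℝ)) ≤
      ∑ i : Fin m, clamp (v - 1 - t i - (i : ℝ)) :=
    Finset.sum_le_sum fun i _ => clamp_monotone (by linarith)
  unfold qt
  linarith

/-- **Basic properties of `q_t`.** For a strictly increasing tuple `t` of event times in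
`[0, T]`, the map `q_t` is nondecreasing and `1`-Lipschitz on `[0, T+m+1]`, satisfies
`q_t(0) = 0` and `q_t(T+m+1) = T`, and maps `[0, T+m+1]` onto `[0, T]`. -/
theorem qt_basic_properties
    (T : ℝ) (hT : 0 < T) (m : ℕ)
    (t : Fin m → ℝ) (ht : StrictMono t) (htmem : ∀ i, t i ∈ Set.Icc 0 T) :
    MonotoneOn (qt t) (Set.Icc 0 (T + m + 1)) ∧
    (∀ u ∈ Set.Icc (0 : ℝ) (T + m + 1), ∀ v ∈ Set.Icc (0 : ℝ) (T + m + 1),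
      |qt t u - qt t v| ≤ |u - v|) ∧
    qt t 0 = 0 ∧
    qt t (T + m + 1) = T ∧
    qt t '' Set.Icc 0 (T + m + 1) = Set.Icc 0 T := by
  have hm : (0 : ℝ) ≤ m := m.cast_nonneg
  have hend : ∀ i : Fin m, 1 + t i + (i : ℝ) + 1 ≤ T + m + 1 := fun i => by
    have h1 : ((i : ℕ) : ℝ) + 1 ≤ m := by exact_mod_cast i.isLt
    linarith [(htmem i).2]
  have hmono : MonotoneOn (qt t) (Set.Icc 0 (T + m + 1)) := by
    intro u hu v hv huv
    have h := monotone_min_sub_sum_clamp t ht (fun i => (htmem i).1) (T + m + 1)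
      (by linarith) hend huv
    simpa only [qt, min_eq_left hu.2, min_eq_left hv.2] using h
  have hzero : qt t 0 = 0 := by
    have h : ∀ i : Fin m, clamp (0 - 1 - t i - (i : ℝ)) = 0 := fun i =>
      clamp_of_nonpos (by
        have : (0 : ℝ) ≤ (i : ℕ) := Nat.cast_nonneg _
        linarith [(htmem i).1])
    simp only [qt, h, clamp_of_nonpos le_rfl, Finset.sum_const_zero, sub_zero]
  have hT' : qt t (T + m + 1) = T := by
    have h : ∀ i : Fin m, clamp (T + m + 1 - 1 - t i - (i : ℝ)) = 1 := fun i =>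
      clamp_of_one_le (by linarith [hend i])
    have h1 : clamp (T + m + 1) = 1 := clamp_of_one_le (by linarith)
    simp only [qt, h, h1, Finset.sum_const, Finset.card_univ, Fintype.card_fin, nsmul_eq_mul]
    ring
  have hle : (0 : ℝ) ≤ T + m + 1 := by linarith
  refine ⟨hmono, fun u hu v hv => ?_, hzero, hT', ?_⟩
  · rcases le_total u v with h | h
    · rw [abs_sub_comm, abs_sub_comm u, abs_of_nonneg (sub_nonneg.2 (hmono hu hv h)),
        abs_of_nonneg (sub_nonneg.2 h)]
      exact qt_sub_qt_le t h
    · rw [abs_of_nonneg (sub_nonneg.2 (hmono hv hu h)), abs_of_nonneg (sub_nonneg.2 h)]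
      exact qt_sub_qt_le t h
  · apply Set.Subset.antisymm
    · simpa only [hzero, hT'] using hmono.image_Icc_subset
    · simpa only [hzero, hT'] using intermediate_value_Icc hle (continuous_qt t).continuousOn
end

section
/- Fix d_disc, d_cont, m ∈ ℕ and T > 0, and set d_X = 2·d_disc + d_cont. The map sending a triple (C, t, δ), consisting of a continuous path C : [0,T] → ℝ^{d_cont}, a strictly increasing tuple t = (t₀, …, t_{m−1}) in [0,T], and increments δ = (δ₀, …, δ_{m−1}) ∈ (ℝ^{2·d_disc})^m, to the realised path Ψ_{C,t,δ} ∈ C([0, T+m+1]; ℝ^{d_X}) is continuous, where the space of continuous paths C carries the uniform topology, the tuples t and δ carry the Euclidean topology, and the target carries the uniform topology. Equivalently, if C^{(j)} → C uniformly, t^{(j)} → t, and δ^{(j)} → δ, then Ψ_{C^{(j)},t^{(j)},δ^{(j)}} → Ψ_{C,t,δ} uniformly on [0, T+m+1]. -/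
open Filter

/-- Embed `v ∈ ℝ^{d_cont}` into `ℝ^{2·d_disc + d_cont}`, occupying the last `d_cont`
coordinates, with zeros elsewhere. -/
noncomputable def embedCont (dd dc : ℕ) (v : Fin dc → ℝ) : Fin (2 * dd + dc) → ℝ :=
  fun k => if h : (k : ℕ) < 2 * dd then 0
    else v ⟨(k : ℕ) - 2 * dd, by have := k.isLt; omega⟩

/-- Embed `w ∈ ℝ^{2·d_disc}` into `ℝ^{2·d_disc + d_cont}`, occupying the first
`2·d_disc` coordinates, with zeros elsewhere. -/
noncomputable def embedDisc (dd dc : ℕ) (w : Fin (2 * dd) → ℝ) : Fin (2 * dd + dc) → ℝ :=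
  fun k => if h : (k : ℕ) < 2 * dd then w ⟨(k : ℕ), h⟩ else 0

/-- The realised path `Ψ_{C,t,δ} : [0, T+m+1] → ℝ^{d_X}` associated with a continuous
path `C` of continuously observed channels, event times `t`, and event increments `δ`. -/
noncomputable def Psi (dd dc m : ℕ) (C : ℝ → Fin dc → ℝ) (t : Fin m → ℝ)
    (δ : Fin m → Fin (2 * dd) → ℝ) (u : ℝ) : Fin (2 * dd + dc) → ℝ :=
  clamp u • embedCont dd dc (C 0)
    + (embedCont dd dc (C (qt t u)) - embedCont dd dc (C 0))
    + ∑ i : Fin m, clamp (u - 1 - t i - (i : ℝ)) • embedDisc dd dc (δ i)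

theorem clamp_nonneg (s : ℝ) : 0 ≤ clamp s :=
  le_min zero_le_one (le_max_left 0 s)

theorem clamp_le_one (s : ℝ) : clamp s ≤ 1 :=
  min_le_left 1 _

theorem clamp_mono {a b : ℝ} (h : a ≤ b) : clamp a ≤ clamp b :=
  min_le_min_left 1 (max_le_max_left 0 h)

theorem abs_clamp_sub_clamp_le (a b : ℝ) : |clamp a - clamp b| ≤ |a - b| := by
  unfold clamp
  rcases abs_cases (a - b) with h | h <;> rw [abs_le] <;> constructor <;> grind

theorem sum_clamp_sub_natCast (m : ℕ) (v : ℝ) :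
    ∑ i : Fin m, clamp (v - (i : ℝ)) = min (m : ℝ) (max 0 v) := by
  induction m with
  | zero => simp
  | succ n ih =>
    rw [Fin.sum_univ_castSucc]
    simp only [Fin.val_castSucc, Fin.val_last, ih]
    rw [clamp, Nat.cast_succ]
    have : (0 : ℝ) ≤ n := n.cast_nonneg
    grind

/-- The physical-time coordinate stays in `[0, T]`. -/
theorem qt_mem_Icc {m : ℕ} {T : ℝ} (hT : 0 ≤ T) {t : Fin m → ℝ} (ht : ∀ i, t i ∈ Set.Icc 0 T)
    {u : ℝ} (hu : u ∈ Set.Icc 0 (T + m + 1)) : qt t u ∈ Set.Icc 0 T := by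
  obtain ⟨hu0, huT⟩ := hu
  have upper : ∑ i : Fin m, clamp (u - 1 - t i - (i : ℝ)) ≤ min (m : ℝ) (max 0 (u - 1)) := by
    rw [← sum_clamp_sub_natCast]
    exact Finset.sum_le_sum fun i _ => clamp_mono (by linarith [(ht i).1])
  have lower : min (m : ℝ) (max 0 (u - 1 - T)) ≤ ∑ i : Fin m, clamp (u - 1 - t i - (i : ℝ)) := by
    rw [← sum_clamp_sub_natCast]
    exact Finset.sum_le_sum fun i _ => clamp_mono (by linarith [(ht i).2])
  have hm : (0 : ℝ) ≤ m := m.cast_nonneg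
  have hclamp : u - clamp u = max 0 (u - 1) := by unfold clamp; grind
  unfold qt
  rw [hclamp]
  constructor <;> grind

theorem Psi_apply_of_lt (dd dc m : ℕ) (C : ℝ → Fin dc → ℝ) (t : Fin m → ℝ)
    (δ : Fin m → Fin (2 * dd) → ℝ) (u : ℝ) (k : Fin (2 * dd + dc)) (h : (k : ℕ) < 2 * dd) :
    Psi dd dc m C t δ u k = ∑ i : Fin m, clamp (u - 1 - t i - (i : ℝ)) * δ i ⟨k, h⟩ := by
  simp [Psi, embedCont, embedDisc, h]

theorem Psi_apply_of_not_lt (dd dc m : ℕ) (C : ℝ → Fin dc → ℝ) (t : Fin m → ℝ)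
    (δ : Fin m → Fin (2 * dd) → ℝ) (u : ℝ) (k : Fin (2 * dd + dc)) (h : ¬ (k : ℕ) < 2 * dd) :
    Psi dd dc m C t δ u k =
      clamp u * C 0 ⟨(k : ℕ) - 2 * dd, by have := k.isLt; omega⟩
        + (C (qt t u) ⟨(k : ℕ) - 2 * dd, by have := k.isLt; omega⟩
          - C 0 ⟨(k : ℕ) - 2 * dd, by have := k.isLt; omega⟩) := by
  simp [Psi, embedCont, embedDisc, h]

theorem tendsto_clamp_mul_zero {α : Type*} {l : Filter α} (s : α → ℝ) {f : α → ℝ}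
    (hf : Tendsto f l (nhds 0)) : Tendsto (fun x => clamp (s x) * f x) l (nhds 0) := by
  refine squeeze_zero_norm (fun x => ?_) (tendsto_norm_zero.comp hf)
  rw [norm_mul, Real.norm_of_nonneg (clamp_nonneg _)]
  exact mul_le_of_le_one_left (norm_nonneg _) (clamp_le_one _)

theorem tendsto_clamp_sub_clamp_zero {α : Type*} {l : Filter α} {f g : α → ℝ}
    (h : Tendsto (fun x => f x - g x) l (nhds 0)) :
    Tendsto (fun x => clamp (f x) - clamp (g x)) l (nhds 0) :=
  squeeze_zero_norm (fun x => abs_clamp_sub_clamp_le (f x) (g x)) (tendsto_norm_zero.comp h)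

/-- Uniformly convergent maps composed with uniformly close arguments stay uniformly close, when
the limit is uniformly continuous. -/
theorem TendstoUniformlyOn.tendsto_comp_sub_comp_zero {ι α X E : Type*} [PseudoMetricSpace X]
    [SeminormedAddCommGroup E] {p : Filter ι} {l : Filter α} {s : Set X} {F : ι → X → E}
    {f : X → E} (hF : TendstoUniformlyOn F f p s) (hf : UniformContinuousOn f s)
    {n : α → ι} (hn : Tendsto n l p) {x y : α → X} (hx : ∀ᶠ a in l, x a ∈ s)
    (hy : ∀ᶠ a in l, y a ∈ s) (hxy : Tendsto (fun a => dist (x a) (y a)) l (nhds 0)) :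
    Tendsto (fun a => F (n a) (x a) - f (y a)) l (nhds 0) := by
  rw [Metric.tendsto_nhds]
  intro ε hε
  obtain ⟨η, hη, hfη⟩ := Metric.uniformContinuousOn_iff.1 hf (ε / 2) (half_pos hε)
  filter_upwards [hn.eventually (Metric.tendstoUniformlyOn_iff.1 hF (ε / 2) (half_pos hε)),
    hx, hy, hxy.eventually (gt_mem_nhds hη)] with a hFa hxa hya hxya
  rw [dist_zero_right, ← dist_eq_norm]
  have h₁ := hFa (x a) hxa
  have h₂ := hfη (x a) hxa (y a) hya hxya
  rw [dist_comm] at h₁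
  linarith [dist_triangle (F (n a) (x a)) (f (x a)) (f (y a))]

/-- **Continuity of the realised-path embedding** on a fixed event-pattern component,
in sequential form: if `C⁽ʲ⁾ → C` uniformly on `[0, T]`, `t⁽ʲ⁾ → t`, and `δ⁽ʲ⁾ → δ`,
then `Ψ_{C⁽ʲ⁾,t⁽ʲ⁾,δ⁽ʲ⁾} → Ψ_{C,t,δ}` uniformly on `[0, T+m+1]`. -/
theorem psi_continuous_in_data
    (dd dc m : ℕ) (T : ℝ) (hT : 0 < T)
    (C : ℕ → ℝ → Fin dc → ℝ) (Clim : ℝ → Fin dc → ℝ)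
    (hCcont : ∀ j, ContinuousOn (C j) (Set.Icc 0 T))
    (hClimcont : ContinuousOn Clim (Set.Icc 0 T))
    (hCconv : TendstoUniformlyOn C Clim atTop (Set.Icc 0 T))
    (t : ℕ → Fin m → ℝ) (tlim : Fin m → ℝ)
    (htmono : ∀ j, StrictMono (t j)) (htlimmono : StrictMono tlim)
    (htmem : ∀ j i, t j i ∈ Set.Icc 0 T) (htlimmem : ∀ i, tlim i ∈ Set.Icc 0 T)
    (htconv : ∀ i, Tendsto (fun j => t j i) atTop (nhds (tlim i)))
    (δ : ℕ → Fin m → Fin (2 * dd) → ℝ) (δlim : Fin m → Fin (2 * dd) → ℝ)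
    (hδconv : ∀ i k, Tendsto (fun j => δ j i k) atTop (nhds (δlim i k))) :
    TendstoUniformlyOn (fun j u => Psi dd dc m (C j) (t j) (δ j) u)
      (fun u => Psi dd dc m Clim tlim δlim u) atTop (Set.Icc 0 (T + m + 1)) := by
  have hdiff : Tendsto (fun p : ℕ × ℝ => Psi dd dc m (C p.1) (t p.1) (δ p.1) p.2
      - Psi dd dc m Clim tlim δlim p.2) (atTop ×ˢ 𝓟 (Set.Icc 0 (T + m + 1))) (nhds 0) := by
    set l : Filter (ℕ × ℝ) := atTop ×ˢ 𝓟 (Set.Icc 0 (T + m + 1))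
    have hfst : Tendsto Prod.fst l atTop := tendsto_fst
    have hsnd : ∀ᶠ p : ℕ × ℝ in l, p.2 ∈ Set.Icc 0 (T + m + 1) :=
      tendsto_snd.eventually (mem_principal_self _)
    have hclamp (i : Fin m) : Tendsto (fun p : ℕ × ℝ => clamp (p.2 - 1 - t p.1 i - (i : ℝ))
        - clamp (p.2 - 1 - tlim i - (i : ℝ))) l (nhds 0) := by
      apply tendsto_clamp_sub_clamp_zero
      have := (tendsto_const_nhds (x := tlim i)).sub ((htconv i).comp hfst)
      rw [sub_self] at this
      refine this.congr fun p => ?_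
      simp only [Function.comp_apply]
      ring
    rw [tendsto_pi_nhds]
    intro k
    simp only [Pi.sub_apply, Pi.zero_apply]
    by_cases hk : (k : ℕ) < 2 * dd
    · simp only [Psi_apply_of_lt _ _ _ _ _ _ _ _ hk, ← Finset.sum_sub_distrib]
      rw [← Finset.sum_const_zero (s := (Finset.univ : Finset (Fin m)))]
      refine tendsto_finsetSum _ fun i _ => ?_
      have hδ := tendsto_clamp_mul_zero (fun p : ℕ × ℝ => p.2 - 1 - t p.1 i - (i : ℝ))
        (tendsto_sub_nhds_zero_iff.2 ((hδconv i ⟨k, hk⟩).comp hfst))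
      have := hδ.add ((hclamp i).mul_const (δlim i ⟨k, hk⟩))
      rw [zero_mul, add_zero] at this
      refine this.congr fun p => ?_
      simp only [Function.comp_apply]
      ring
    · simp only [Psi_apply_of_not_lt _ _ _ _ _ _ _ _ hk]
      set k' : Fin dc := ⟨(k : ℕ) - 2 * dd, by have := k.isLt; omega⟩
      have hC₀ : Tendsto (fun p : ℕ × ℝ => C p.1 0 k' - Clim 0 k') l (nhds 0) :=
        tendsto_sub_nhds_zero_iff.2 ((tendsto_pi_nhds.1
          (hCconv.tendsto_at (Set.left_mem_Icc.2 hT.le)) k').comp hfst)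
      have hq : Tendsto (fun p : ℕ × ℝ => dist (qt (t p.1) p.2) (qt tlim p.2)) l (nhds 0) := by
        have := tendsto_finsetSum Finset.univ fun i _ => hclamp i
        rw [Finset.sum_const_zero] at this
        refine (tendsto_norm_zero.comp this).congr fun p => ?_
        rw [Function.comp_apply, Finset.sum_sub_distrib, dist_comm, dist_eq_norm, qt, qt]
        congr 1
        ring
      have hCq := tendsto_pi_nhds.1 (hCconv.tendsto_comp_sub_comp_zero
        (isCompact_Icc.uniformContinuousOn_of_continuous hClimcont) hfst
        (hsnd.mono fun p hp => qt_mem_Icc hT.le (htmem p.1) hp)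
        (hsnd.mono fun p hp => qt_mem_Icc hT.le htlimmem hp) hq) k'
      have := (tendsto_clamp_mul_zero Prod.snd hC₀).add (hCq.sub hC₀)
      simp only [Pi.zero_apply, sub_zero, add_zero] at this
      refine this.congr fun p => ?_
      simp only [Pi.sub_apply]
      ring
  rw [Metric.tendstoUniformlyOn_iff]
  intro ε hε
  have := eventually_prod_principal_iff.1 (Metric.tendsto_nhds.1 hdiff ε hε)
  simpa only [dist_zero_right, ← dist_eq_norm, dist_comm] using this
end
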